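/- For the kernel K on [0,1] one has λ(x) = c/2 + c·log 2 for every x ∈ (0, 1/2], and λ(x) = c/2 + c·log(1/x) for every x ∈ (1/2, 1]. Consequently the isolation parameter satisfies Λ = essinf_{x∈[0,1]} λ(x) = c/2. -/

import Mathlib

open MeasureTheory Filter Set

noncomputable section

/-- The example kernel of Section 4 on `S = [0,1]`:
`K(x,y) = (c/x) 1_{[x/2,x]}(y) + (c/y) 1_{[y/2,y]}(x)` for `x, y ∈ (0,1]`, and `K = 0` when
`x = 0` or `y = 0` (note that both clauses below indeed vanish in that case). -/
def Kex (c : ℝ) (x y : ℝ) : ℝ :=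
  (if y ∈ Set.Icc (x/2) x then c / x else 0) + (if x ∈ Set.Icc (y/2) y then c / y else 0)

/-- The kernel, as a function of its second variable, is a sum of two indicators. -/
theorem Kex_eq_indicator_add_indicator (c x y : ℝ) :
    Kex c x y = (Icc (x/2) x).indicator (fun _ => c / x) y +
      (Icc x (2 * x)).indicator (fun y => c / y) y := by
  have h : x ∈ Icc (y/2) y ↔ y ∈ Icc x (2 * x) := by
    simp only [mem_Icc]
    constructor <;> rintro ⟨h₁, h₂⟩ <;> constructor <;> linarith
  simp only [Kex, indicator_apply, h]

theorem integral_Kex (c : ℝ) {x : ℝ} (hx : x ∈ Ioc (0:ℝ) 1) :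
    ∫ y in (0:ℝ)..1, Kex c x y = c/2 + c * Real.log (min (2 * x) 1 / x) := by
  obtain ⟨hx0, hx1⟩ := hx
  have hxm : x ≤ min (2 * x) 1 := le_min (by linarith) hx1
  have inter_left : Ioc (0:ℝ) 1 ∩ Icc (x/2) x = Icc (x/2) x :=
    inter_eq_right.2 fun y hy => ⟨by linarith [hy.1], hy.2.trans hx1⟩
  have inter_right : Ioc (0:ℝ) 1 ∩ Icc x (2 * x) = Icc x (min (2 * x) 1) := by
    ext y
    simp only [mem_inter_iff, mem_Ioc, mem_Icc, le_min_iff]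
    constructor
    · tauto
    · rintro ⟨h₁, h₂, h₃⟩
      exact ⟨⟨by linarith, h₃⟩, h₁, h₂⟩
  have integrable_left : IntegrableOn ((Icc (x/2) x).indicator fun _ => c / x) (Ioc (0:ℝ) 1) :=
    (integrableOn_const (by simp)).indicator measurableSet_Icc
  have integrable_right :
      IntegrableOn ((Icc x (2 * x)).indicator fun y => c / y) (Ioc (0:ℝ) 1) := by
    have h : IntegrableOn (fun y => c / y) (Icc x (2 * x)) :=
      (continuousOn_const.div continuousOn_id
        fun y hy => (hx0.trans_le hy.1).ne').integrableOn_Icc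
    exact ((integrable_indicator_iff measurableSet_Icc).2 h).integrableOn
  have log_integral : ∫ y in x..min (2 * x) 1, c / y = c * Real.log (min (2 * x) 1 / x) := by
    simp only [div_eq_mul_inv c, intervalIntegral.integral_const_mul]
    rw [integral_inv_of_pos hx0 (hx0.trans_le hxm)]
  simp only [Kex_eq_indicator_add_indicator]
  rw [intervalIntegral.integral_of_le zero_le_one,
    integral_add integrable_left integrable_right,
    setIntegral_indicator measurableSet_Icc, setIntegral_indicator measurableSet_Icc,
    inter_left, inter_right, setIntegral_const, integral_Icc_eq_integral_Ioc,
    ← intervalIntegral.integral_of_le hxm, log_integral, Real.volume_real_Icc_of_le (by linarith),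
    smul_eq_mul]
  congr 1
  field_simp
  ring

theorem integral_Kex_of_le_half (c : ℝ) {x : ℝ} (hx : x ∈ Ioc (0:ℝ) (1/2)) :
    ∫ y in (0:ℝ)..1, Kex c x y = c/2 + c * Real.log 2 := by
  rw [integral_Kex c ⟨hx.1, by linarith [hx.2]⟩, min_eq_left (by linarith [hx.2]),
    mul_div_cancel_right₀ _ hx.1.ne']

theorem integral_Kex_of_half_lt (c : ℝ) {x : ℝ} (hx : x ∈ Ioc (1/2 : ℝ) 1) :
    ∫ y in (0:ℝ)..1, Kex c x y = c/2 + c * Real.log (1/x) := by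
  rw [integral_Kex c ⟨by linarith [hx.1], hx.2⟩, min_eq_right (by linarith [hx.1])]

theorem half_le_integral_Kex {c x : ℝ} (hc : 0 ≤ c) (hx : x ∈ Ioc (0:ℝ) 1) :
    c/2 ≤ ∫ y in (0:ℝ)..1, Kex c x y := by
  rw [integral_Kex c hx]
  have h : 1 ≤ min (2 * x) 1 / x :=
    (one_le_div hx.1).2 (le_min (by linarith [hx.1]) hx.2)
  have := mul_nonneg hc (Real.log_nonneg h)
  linarith

/-- An almost everywhere lower bound of the degree function is at most `c/2`, the limit of the
degree function at `1`. -/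
theorem le_half_of_ae_le_integral_Kex {c a : ℝ}
    (ha : ∀ᵐ x ∂volume.restrict (Icc (0:ℝ) 1), a ≤ ∫ y in (0:ℝ)..1, Kex c x y) :
    a ≤ c/2 := by
  have hlim : Tendsto (fun x : ℝ => c/2 + c * Real.log (1/x)) (nhdsWithin 1 (Iio 1))
      (nhds (c/2)) := by
    have h : ContinuousAt (fun x : ℝ => c/2 + c * Real.log (1/x)) 1 := by
      fun_prop (disch := norm_num)
    simpa using h.tendsto.mono_left nhdsWithin_le_nhds
  refine ge_of_tendsto_of_frequently hlim fun hev => ?_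
  obtain ⟨l, hl, hsub⟩ := (mem_nhdsLT_iff_exists_Ioo_subset' (zero_lt_one' ℝ)).1 hev
  have hlt : max l (1/2) < 1 := max_lt hl (by norm_num)
  have hnull := (ae_restrict_iff' measurableSet_Icc).1 ha
  have hpos : volume (Ioo (max l (1/2)) 1) ≠ 0 := by simpa using hlt
  obtain ⟨x, hx, hxa⟩ := (frequently_ae_mem_iff.2 hpos).and_eventually hnull |>.exists
  have hx2 : 1/2 < x := (le_max_right _ _).trans_lt hx.1
  have := hxa ⟨by linarith, hx.2.le⟩
  rw [integral_Kex_of_half_lt c ⟨hx2, hx.2.le⟩] at this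
  exact hsub ⟨(le_max_left _ _).trans_lt hx.1, hx.2⟩ this

/-- **The degree function of the example kernel** (Section 4):
`λ(x) = c/2 + c log 2` on `(0,1/2]`, `λ(x) = c/2 + c log(1/x)` on `(1/2,1]`, and the
isolation parameter is `Λ = essinf λ = c/2`. -/
theorem example_kernel_lambda (c : ℝ) (hc : 0 < c) :
    (∀ x ∈ Set.Ioc (0:ℝ) (1/2), (∫ y in (0:ℝ)..1, Kex c x y) = c/2 + c * Real.log 2) ∧
    (∀ x ∈ Set.Ioc (1/2 : ℝ) 1, (∫ y in (0:ℝ)..1, Kex c x y) = c/2 + c * Real.log (1/x)) ∧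
    essInf (fun x => ∫ y in (0:ℝ)..1, Kex c x y)
        (volume.restrict (Set.Icc (0:ℝ) 1)) = c/2 := by
  refine ⟨fun x hx => integral_Kex_of_le_half c hx, fun x hx => integral_Kex_of_half_lt c hx, ?_⟩
  have hae : ∀ᵐ x ∂volume.restrict (Icc (0:ℝ) 1), c/2 ≤ ∫ y in (0:ℝ)..1, Kex c x y := by
    rw [← restrict_Ioc_eq_restrict_Icc]
    exact ae_restrict_of_forall_mem measurableSet_Ioc fun x hx => half_le_integral_Kex hc.le hx
  rw [essInf, liminf_eq]
  exact IsGreatest.csSup_eq ⟨hae, fun a ha => le_half_of_ae_le_integral_Kex ha⟩
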